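/- arXiv:1107.0742 — 2 statements merged into one kernel-verified Lean document; each statement's English description precedes it below -/
import Mathlib

section
/- Let τ be a Hopf algebra automorphism of H with τ² = Id, and let (V,ρ) be an irreducible finite-dimensional left H-module with character χ. Then ν₂(χ,τ) = 1 if and only if there exists a nonzero symmetric H-module intertwiner V† → V, and ν₂(χ,τ) = −1 if and only if there exists a nonzero skew-symmetric H-module intertwiner V† → V. -/
open TensorProduct

noncomputable section

universe u

variable (k : Type u) [Field k]

/-- `twistedMulMap τ n : h ↦ Σ h₁ · τ(h₂) · ⋯ · τⁿ(h_{n+1})`, the product of the `n+1`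
Sweedler factors of the iterated comultiplication with the twist `τ` applied progressively.
For `n = 1` this is `h ↦ Σ h₁ τ(h₂)`, so that the second twisted Frobenius–Schur indicator
is `ν₂(χ, τ) = χ (twistedMulMap τ 1 Λ)`. -/
def twistedMulMap (H : Type u) [Ring H] [HopfAlgebra k H] (τ : H →ₗ[k] H) :
    ℕ → (H →ₗ[k] H)
  | 0 => LinearMap.id
  | n + 1 => LinearMap.mul' k H ∘ₗ TensorProduct.map LinearMap.id (τ ∘ₗ twistedMulMap H τ n)
      ∘ₗ Coalgebra.comul (R := k)

/-- The transpose `f ↦ fᵗ = Ψ⁻¹ ∘ f†` of maps `V† → V`, where `Ψ : V ≃ V**` is evaluation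
and `f†` is the usual dual map. -/
def transposeMap (V : Type u) [AddCommGroup V] [Module k V] [FiniteDimensional k V] :
    (Module.Dual k V →ₗ[k] V) →ₗ[k] (Module.Dual k V →ₗ[k] V) :=
  LinearMap.llcomp k (Module.Dual k V) (Module.Dual k (Module.Dual k V)) V
      (Module.evalEquiv k V).symm.toLinearMap ∘ₗ Module.Dual.transpose (R := k)

/-- The space `Hom_H(V†, V)` of `H`-module maps from the twisted dual `V†` (the dual space
of `V` with the `H`-action `(h · f)(v) = f(T(h) · v)`, `T = τ ∘ S`) to `V`. -/
def homHSub (H V : Type u) [Ring H] [HopfAlgebra k H] [AddCommGroup V] [Module k V]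
    (τ : H →ₗ[k] H) (ρ : H →ₐ[k] Module.End k V) :
    Submodule k (Module.Dual k V →ₗ[k] V) where
  carrier := {f | ∀ h : H,
    ρ h ∘ₗ f = f ∘ₗ (ρ (τ (HopfAlgebra.antipode (R := k) h))).dualMap}
  add_mem' := by
    intro f g hf hg h
    simp only [LinearMap.comp_add, LinearMap.add_comp, hf h, hg h]
  zero_mem' := by
    intro h
    simp
  smul_mem' := by
    intro c f hf h
    simp only [LinearMap.comp_smul, LinearMap.smul_comp, hf h]


/-- If the endomorphism `σ` preserves the image of an idempotent `E` of rank at most one, then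
`trace (σ ∘ E) = c ≠ 0` exactly when `σ` has an eigenvector for `c` in that image. -/
theorem trace_mul_eq_iff_exists_eigenvector {M : Type u} [AddCommGroup M] [Module k M]
    [FiniteDimensional k M] (σ E : Module.End k M) (hE : ∀ x, E (E x) = E x)
    (hσ : ∀ x, E x = x → E (σ x) = σ x)
    (hrank : ∀ x y, E x = x → E y = y → x ≠ 0 → ∃ c : k, y = c • x) {c : k} (hc : c ≠ 0) :
    LinearMap.trace k M (σ * E) = c ↔ ∃ t, E t = t ∧ t ≠ 0 ∧ σ t = c • t := by
  by_cases h : ∃ t, E t = t ∧ t ≠ 0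
  · obtain ⟨t, ht, ht0⟩ := h
    obtain ⟨d, hd⟩ := hrank t (σ t) ht (hσ t ht) ht0
    obtain ⟨g, hg⟩ := Module.Projective.exists_dual_eq_one k ht0
    have key : σ * E = (g ∘ₗ E).smulRight (d • t) := by
      ext x
      obtain ⟨a, ha⟩ := hrank t (E x) ht (hE x) ht0
      simp [ha, hg, hd]
    have htr : LinearMap.trace k M (σ * E) = d := by
      rw [key, LinearMap.trace_smulRight]
      simp [ht, hg]
    rw [htr]
    constructor
    · rintro rfl
      exact ⟨t, ht, ht0, hd⟩
    · rintro ⟨s, hs, hs0, hsc⟩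
      obtain ⟨a, rfl⟩ := hrank t s ht hs ht0
      rw [map_smul, hd, smul_comm a d t] at hsc
      exact smul_left_injective k hs0 hsc
  · have hE0 : E = 0 := by
      ext x
      by_contra hx
      exact h ⟨E x, hE x, hx⟩
    simp only [hE0, mul_zero, map_zero]
    constructor
    · intro h0
      exact absurd h0.symm hc
    · rintro ⟨t, ht, ht0, -⟩
      exact absurd ht.symm ht0

/-- The trace of the flip composed with `a ⊗ b` is the trace of `a * b`. -/
theorem trace_comm_comp_map {V : Type u} [AddCommGroup V] [Module k V] [FiniteDimensional k V]
    (a b : Module.End k V) :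
    LinearMap.trace k (V ⊗[k] V) ((TensorProduct.comm k V V).toLinearMap ∘ₗ TensorProduct.map a b) =
      LinearMap.trace k V (a * b) := by
  obtain ⟨x, rfl⟩ := (dualTensorHomEquiv k V V).surjective a
  obtain ⟨y, rfl⟩ := (dualTensorHomEquiv k V V).surjective b
  induction x using TensorProduct.induction_on with
  | zero => simp
  | add x₁ x₂ h₁ h₂ => simp only [map_add, TensorProduct.map_add_left, LinearMap.comp_add, add_mul,
      h₁, h₂]
  | tmul φ v =>
    induction y using TensorProduct.induction_on with
    | zero => simp
    | add y₁ y₂ h₁ h₂ => simp only [map_add, TensorProduct.map_add_right, LinearMap.comp_add,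
        mul_add, h₁, h₂]
    | tmul ψ w =>
      have h₁ : (TensorProduct.comm k V V).toLinearMap ∘ₗ
          TensorProduct.map (dualTensorHomEquiv k V V (φ ⊗ₜ v))
            (dualTensorHomEquiv k V V (ψ ⊗ₜ w)) =
          (LinearMap.mul' k k ∘ₗ TensorProduct.map φ ψ).smulRight (w ⊗ₜ[k] v) := by
        ext x y
        simp [dualTensorHom_apply, TensorProduct.smul_tmul', TensorProduct.tmul_smul, smul_smul,
          mul_comm]
      have h₂ : dualTensorHomEquiv k V V (φ ⊗ₜ v) * dualTensorHomEquiv k V V (ψ ⊗ₜ w) =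
          (ψ.smulRight (φ w • v) : Module.End k V) := by
        ext x
        simp [dualTensorHom_apply]
      rw [h₁, h₂, LinearMap.trace_smulRight, LinearMap.trace_smulRight]
      simp

/-- The identification of `V ⊗ V` with the maps `V* → V`, sending `v ⊗ w` to `φ ↦ φ v • w`. -/
def tensorEquivDualHom (V : Type u) [AddCommGroup V] [Module k V] [FiniteDimensional k V] :
    (V ⊗[k] V) ≃ₗ[k] (Module.Dual k V →ₗ[k] V) :=
  (TensorProduct.congr (Module.evalEquiv k V) (LinearEquiv.refl k V)).trans
    (dualTensorHomEquiv k (Module.Dual k V) V)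

theorem tensorEquivDualHom_tmul {V : Type u} [AddCommGroup V] [Module k V] [FiniteDimensional k V]
    (v w : V) (φ : Module.Dual k V) : tensorEquivDualHom k V (v ⊗ₜ w) φ = φ v • w := by
  simp [tensorEquivDualHom, dualTensorHom_apply]

theorem tensorEquivDualHom_map {V : Type u} [AddCommGroup V] [Module k V] [FiniteDimensional k V]
    (a b : Module.End k V) (t : V ⊗[k] V) :
    tensorEquivDualHom k V (TensorProduct.map a b t) =
      b ∘ₗ tensorEquivDualHom k V t ∘ₗ a.dualMap := by
  induction t using TensorProduct.induction_on with
  | zero => simp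
  | add x y hx hy => simp only [map_add, hx, hy, LinearMap.add_comp, LinearMap.comp_add]
  | tmul v w =>
    ext φ
    simp [tensorEquivDualHom_tmul]

theorem tensorEquivDualHom_comm {V : Type u} [AddCommGroup V] [Module k V] [FiniteDimensional k V]
    (t : V ⊗[k] V) :
    tensorEquivDualHom k V (TensorProduct.comm k V V t) =
      transposeMap k V (tensorEquivDualHom k V t) := by
  induction t using TensorProduct.induction_on with
  | zero => simp
  | add x y hx hy => simp only [map_add, hx, hy]
  | tmul v w =>
    ext φ
    apply (Module.evalEquiv k V).injective
    ext ψ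
    simp [tensorEquivDualHom_tmul, transposeMap, Module.Dual.transpose, mul_comm]

/-- The componentwise action of `H ⊗ H` on `V ⊗ V`. -/
def tensorAction {H V : Type u} [Ring H] [Algebra k H] [AddCommGroup V] [Module k V]
    (ρ : H →ₐ[k] Module.End k V) : H ⊗[k] H →ₐ[k] Module.End k (V ⊗[k] V) :=
  (Module.endTensorEndAlgHom (R := k) (S := k) (A := k) (M := V) (N := V)).comp
    (Algebra.TensorProduct.map ρ ρ)

theorem tensorAction_tmul {H V : Type u} [Ring H] [Algebra k H] [AddCommGroup V] [Module k V]
    (ρ : H →ₐ[k] Module.End k V) (a b : H) :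
    tensorAction k ρ (a ⊗ₜ b) = TensorProduct.map (ρ a) (ρ b) := by
  simp [tensorAction, Module.endTensorEndAlgHom_apply, TensorProduct.AlgebraTensorModule.map_eq]

theorem comm_tensorAction {H V : Type u} [Ring H] [Algebra k H] [AddCommGroup V] [Module k V]
    (ρ : H →ₐ[k] Module.End k V) (x : H ⊗[k] H) (t : V ⊗[k] V) :
    TensorProduct.comm k V V (tensorAction k ρ x t) =
      tensorAction k ρ (TensorProduct.comm k H H x) (TensorProduct.comm k V V t) := by
  induction x using TensorProduct.induction_on with
  | zero => simp
  | add x y hx hy => simp only [map_add, LinearMap.add_apply, hx, hy]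
  | tmul a b =>
    induction t using TensorProduct.induction_on with
    | zero => simp
    | add x y hx hy => simp only [map_add, hx, hy]
    | tmul v w => simp [tensorAction_tmul]

theorem trace_comm_tensorAction {H V : Type u} [Ring H] [Algebra k H] [AddCommGroup V] [Module k V]
    [FiniteDimensional k V] (ρ : H →ₐ[k] Module.End k V) (x : H ⊗[k] H) :
    LinearMap.trace k (V ⊗[k] V)
        ((TensorProduct.comm k V V).toLinearMap * tensorAction k ρ x) =
      LinearMap.trace k V (ρ (LinearMap.mul' k H x)) := by
  induction x using TensorProduct.induction_on with
  | zero => simp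
  | add x y hx hy => simp only [map_add, mul_add, hx, hy]
  | tmul a b =>
    rw [tensorAction_tmul, Module.End.mul_eq_comp, trace_comm_comp_map]
    simp

theorem sum_antipode_tmul_one_mul_twisted_comul {H ι : Type u} [Ring H] [HopfAlgebra k H]
    (τ : H →ₐ[k] H) {h : H} (r : Coalgebra.Repr k h ι) :
    ∑ i ∈ r.index, (τ (HopfAlgebra.antipode k (r.left i)) ⊗ₜ[k] (1 : H)) *
      TensorProduct.map τ.toLinearMap LinearMap.id (Coalgebra.comul (R := k) (r.right i)) =
    1 ⊗ₜ h := by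
  let m : H ⊗[k] H →ₗ[k] H :=
    τ.toLinearMap ∘ₗ LinearMap.mul' k H ∘ₗ (HopfAlgebra.antipode k).rTensor H
  let F : H ⊗[k] (H ⊗[k] H) →ₗ[k] H ⊗[k] H :=
    m.rTensor H ∘ₗ (TensorProduct.assoc k H H H).symm.toLinearMap
  have hF (a : H) (x : H ⊗[k] H) : (τ (HopfAlgebra.antipode k a) ⊗ₜ[k] (1 : H)) *
      TensorProduct.map τ.toLinearMap LinearMap.id x = F (a ⊗ₜ x) := by
    induction x using TensorProduct.induction_on with
    | zero => simp
    | add x y hx hy => simp only [map_add, mul_add, TensorProduct.tmul_add, hx, hy]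
    | tmul b c => simp [F, m]
  have hm : m ∘ₗ Coalgebra.comul = Algebra.linearMap k H ∘ₗ Coalgebra.counit := by
    ext a
    simp [m]
  calc _ = F ((Coalgebra.comul (R := k)).lTensor H (Coalgebra.comul (R := k) h)) := by
        rw [← r.eq]
        simp [hF]
    _ = m.rTensor H (Coalgebra.comul.rTensor H (Coalgebra.comul (R := k) h)) := by
        simp [F]
    _ = (Algebra.linearMap k H).rTensor H
          (Coalgebra.counit.rTensor H (Coalgebra.comul (R := k) h)) := by
        rw [← LinearMap.rTensor_comp_apply, hm, LinearMap.rTensor_comp_apply]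
    _ = 1 ⊗ₜ h := by simp

/-- The action of `H` on `V ⊗ V` whose first factor is twisted by `τ`. -/
def twistedTensorAction {H V : Type u} [Ring H] [HopfAlgebra k H] [AddCommGroup V] [Module k V]
    (τ : H →ₐ[k] H) (ρ : H →ₐ[k] Module.End k V) : H →ₐ[k] Module.End k (V ⊗[k] V) :=
  (tensorAction k ρ).comp
    ((Algebra.TensorProduct.map τ (AlgHom.id k H)).comp (Bialgebra.comulAlgHom k H))

theorem twistedTensorAction_apply {H V : Type u} [Ring H] [HopfAlgebra k H] [AddCommGroup V]
    [Module k V] (τ : H →ₐ[k] H) (ρ : H →ₐ[k] Module.End k V) (h : H) :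
    twistedTensorAction k τ ρ h = tensorAction k ρ
      (TensorProduct.map τ.toLinearMap LinearMap.id (Coalgebra.comul (R := k) h)) :=
  rfl

/-- Intertwiners `V† → V` correspond to the invariants of `V ⊗ V`. -/
theorem tensorEquivDualHom_mem_homHSub_iff {H V : Type u} [Ring H] [HopfAlgebra k H]
    [AddCommGroup V] [Module k V] [FiniteDimensional k V]
    (τ : H →ₐ[k] H) (ρ : H →ₐ[k] Module.End k V) (t : V ⊗[k] V) :
    tensorEquivDualHom k V t ∈ homHSub k H V τ.toLinearMap ρ ↔
      ∀ h, twistedTensorAction k τ ρ h t = Coalgebra.counit (R := k) h • t := by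
  have hmem : tensorEquivDualHom k V t ∈ homHSub k H V τ.toLinearMap ρ ↔
      ∀ h, tensorAction k ρ (1 ⊗ₜ h) t =
        tensorAction k ρ (τ (HopfAlgebra.antipode k h) ⊗ₜ 1) t := by
    refine forall_congr' fun h => ?_
    rw [← (tensorEquivDualHom k V).injective.eq_iff, tensorAction_tmul, tensorAction_tmul,
      tensorEquivDualHom_map, tensorEquivDualHom_map]
    simp [Module.End.one_eq_id]
  rw [hmem]
  constructor
  · intro ht h
    have key (x : H ⊗[k] H) :
        tensorAction k ρ (TensorProduct.map τ.toLinearMap LinearMap.id x) t =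
          tensorAction k ρ
            (τ (LinearMap.mul' k H ((HopfAlgebra.antipode k).lTensor H x)) ⊗ₜ 1) t := by
      induction x using TensorProduct.induction_on with
      | zero => simp
      | add x y hx hy => simp only [map_add, TensorProduct.add_tmul, LinearMap.add_apply, hx, hy]
      | tmul a b =>
        have hab : τ a ⊗ₜ[k] b = (τ a ⊗ₜ 1) * (1 ⊗ₜ b) := by simp
        simp only [TensorProduct.map_tmul, AlgHom.toLinearMap_apply, LinearMap.id_apply,
          LinearMap.lTensor_tmul, LinearMap.mul'_apply]
        rw [hab, map_mul, Module.End.mul_apply, ht, ← Module.End.mul_apply, ← map_mul]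
        simp
    rw [twistedTensorAction_apply, key]
    rw [HopfAlgebra.mul_antipode_lTensor_comul_apply, AlgHom.commutes,
      Algebra.algebraMap_eq_smul_one, ← TensorProduct.smul_tmul', map_smul,
      ← Algebra.TensorProduct.one_def, map_one, LinearMap.smul_apply, Module.End.one_apply]
  · intro ht h
    rw [← sum_antipode_tmul_one_mul_twisted_comul k τ (Coalgebra.Repr.arbitrary k h)]
    simp only [map_sum, map_mul, LinearMap.sum_apply, Module.End.mul_apply,
      ← twistedTensorAction_apply, ht]
    have hh := congrArg (TensorProduct.rid k H)
      (Coalgebra.sum_tmul_counit_eq (Coalgebra.Repr.arbitrary k h))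
    simp only [map_sum, TensorProduct.rid_tmul, one_smul] at hh
    conv_rhs => rw [← hh]
    simp only [map_sum, map_smul, TensorProduct.sum_tmul, ← TensorProduct.smul_tmul',
      LinearMap.sum_apply, LinearMap.smul_apply]

/-- **Schur's lemma** for the intertwiners `V† → V`. -/
theorem exists_eq_smul_of_mem_homHSub {H V : Type u} [Ring H] [HopfAlgebra k H] [IsAlgClosed k]
    [AddCommGroup V] [Module k V] [FiniteDimensional k V] [Nontrivial V]
    (τ : H →ₗ[k] H) (ρ : H →ₐ[k] Module.End k V)
    (hirr : ∀ U : Submodule k V, (∀ (h : H) (v : V), v ∈ U → ρ h v ∈ U) → U = ⊥ ∨ U = ⊤)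
    {f g : Module.Dual k V →ₗ[k] V} (hf : f ∈ homHSub k H V τ ρ) (hg : g ∈ homHSub k H V τ ρ)
    (hf0 : f ≠ 0) : ∃ c : k, g = c • f := by
  have hbij (f : Module.Dual k V →ₗ[k] V) (hf : f ∈ homHSub k H V τ ρ) (hf0 : f ≠ 0) :
      Function.Injective f := by
    rw [LinearMap.injective_iff_surjective_of_finrank_eq_finrank Subspace.dual_finrank_eq,
      ← LinearMap.range_eq_top]
    refine (hirr _ ?_).resolve_left fun h => hf0 (LinearMap.range_eq_bot.mp h)
    rintro h _ ⟨φ, rfl⟩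
    exact ⟨_, (LinearMap.congr_fun (hf h) φ).symm⟩
  let e := LinearEquiv.ofInjectiveOfFinrankEq f (hbij f hf hf0) Subspace.dual_finrank_eq
  obtain ⟨c, hc⟩ := Module.End.exists_eigenvalue (g ∘ₗ e.symm.toLinearMap)
  obtain ⟨v, hv⟩ := hc.exists_hasEigenvector
  refine ⟨c, ?_⟩
  by_contra hne
  have hmem := (homHSub k H V τ ρ).sub_mem hg ((homHSub k H V τ ρ).smul_mem c hf)
  have hinj := hbij _ hmem (sub_ne_zero.mpr hne)
  have hfe : f (e.symm v) = v := e.apply_symm_apply v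
  have hv0 : (g - c • f) (e.symm v) = 0 := by
    have := hv.apply_eq_smul
    simp only [LinearMap.comp_apply, LinearEquiv.coe_coe] at this
    simp [this, hfe]
  exact hv.2 (e.symm.map_eq_zero_iff.mp ((map_eq_zero_iff _ hinj).mp hv0))

/-- **Theorem.** For an irreducible finite-dimensional module `(V, ρ)` over a finite-dimensional
semisimple Hopf algebra `H` over an algebraically closed field of characteristic `0`, and a Hopf
algebra automorphism `τ` with `τ² = Id`: the second twisted Frobenius–Schur indicator
`ν₂(χ, τ) = Σ χ(Λ₁ τ(Λ₂))` equals `1` (resp. `-1`) if and only if there is a nonzero symmetric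
(resp. skew-symmetric) `H`-module intertwiner `V† → V`. -/
theorem twisted_second_FS_indicator_eq_one_iff_symmetric_and_neg_one_iff_skew
    (H V : Type u) [Ring H] [HopfAlgebra k H]
    [IsAlgClosed k] [CharZero k] [FiniteDimensional k H] [IsSemisimpleRing H]
    [AddCommGroup V] [Module k V] [FiniteDimensional k V]
    (Λ : H)
    (hΛleft : ∀ a : H, a * Λ = Coalgebra.counit (R := k) a • Λ)
    (hΛright : ∀ a : H, Λ * a = Coalgebra.counit (R := k) a • Λ)
    (hΛone : Coalgebra.counit (R := k) Λ = 1)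
    (hΛcc : TensorProduct.comm k H H (Coalgebra.comul (R := k) Λ) = Coalgebra.comul (R := k) Λ)
    (τ : H →ₗ[k] H)
    (hτmul : ∀ a b : H, τ (a * b) = τ a * τ b) (hτone : τ 1 = 1)
    (hτcomul : Coalgebra.comul (R := k) ∘ₗ τ =
      TensorProduct.map τ τ ∘ₗ Coalgebra.comul (R := k))
    (hτcounit : Coalgebra.counit (R := k) ∘ₗ τ = Coalgebra.counit (R := k))
    (hτsq : τ ∘ₗ τ = LinearMap.id)
    (ρ : H →ₐ[k] Module.End k V)
    [Nontrivial V]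
    (hirr : ∀ U : Submodule k V, (∀ (h : H) (v : V), v ∈ U → ρ h v ∈ U) → U = ⊥ ∨ U = ⊤) :
    (LinearMap.trace k V (ρ (twistedMulMap k H τ 1 Λ)) = 1 ↔
      ∃ f : Module.Dual k V →ₗ[k] V,
        f ∈ homHSub k H V τ ρ ∧ f ≠ 0 ∧ transposeMap k V f = f) ∧
    (LinearMap.trace k V (ρ (twistedMulMap k H τ 1 Λ)) = -1 ↔
      ∃ f : Module.Dual k V →ₗ[k] V,
        f ∈ homHSub k H V τ ρ ∧ f ≠ 0 ∧ transposeMap k V f = -f) := by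
  let τ' : H →ₐ[k] H := AlgHom.ofLinearMap τ hτone hτmul
  have hτ' : τ'.toLinearMap = τ := rfl
  let D := twistedTensorAction k τ' ρ
  let σ : Module.End k (V ⊗[k] V) := (TensorProduct.comm k V V).toLinearMap
  have hDΛ (h : H) (t : V ⊗[k] V) : D h (D Λ t) = Coalgebra.counit (R := k) h • D Λ t := by
    rw [← Module.End.mul_apply, ← map_mul, hΛleft, map_smul, LinearMap.smul_apply]
  have hinv (t : V ⊗[k] V) : tensorEquivDualHom k V t ∈ homHSub k H V τ ρ ↔ D Λ t = t := by
    rw [← hτ', tensorEquivDualHom_mem_homHSub_iff]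
    refine ⟨fun h => by simpa [hΛone] using h Λ, fun ht h => ?_⟩
    rw [← ht]
    exact hDΛ h t
  have hτinv (a : H) : τ (τ a) = a := LinearMap.congr_fun hτsq a
  have hετ : Coalgebra.counit (R := k) (τ Λ) = 1 := by
    rw [← LinearMap.comp_apply, hτcounit, hΛone]
  have hτΛ : τ Λ = Λ := by
    have h₁ := hΛright (τ Λ)
    have h₂ := congrArg τ (hΛleft (τ Λ))
    rw [hετ, one_smul] at h₁ h₂
    rwa [hτmul, hτinv, h₁, eq_comm] at h₂
  have hΔ : TensorProduct.comm k H H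
      (TensorProduct.map τ LinearMap.id (Coalgebra.comul (R := k) Λ)) =
      TensorProduct.map τ LinearMap.id (Coalgebra.comul (R := k) Λ) := by
    have hcomm : TensorProduct.comm k H H
        (TensorProduct.map τ LinearMap.id (Coalgebra.comul (R := k) Λ)) =
        TensorProduct.map LinearMap.id τ (Coalgebra.comul (R := k) Λ) := by
      conv_rhs => rw [← hΛcc]
      rw [TensorProduct.map_comm]
    have hττ := LinearMap.congr_fun hτcomul Λ
    rw [LinearMap.comp_apply, LinearMap.comp_apply, hτΛ] at hττ
    rw [hcomm]
    conv_rhs => rw [hττ]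
    rw [← LinearMap.comp_apply (TensorProduct.map τ LinearMap.id), ← TensorProduct.map_comp, hτsq,
      LinearMap.id_comp]
  have hσ (t : V ⊗[k] V) (ht : D Λ t = t) : D Λ (σ t) = σ t := by
    conv_rhs => rw [← ht]
    change _ = TensorProduct.comm k V V (D Λ t)
    simp only [D, twistedTensorAction_apply, comm_tensorAction, hτ', hΔ]
    rfl
  have htrace : LinearMap.trace k V (ρ (twistedMulMap k H τ 1 Λ)) =
      LinearMap.trace k (V ⊗[k] V) (σ * D Λ) := by
    have hmap : TensorProduct.map LinearMap.id τ (Coalgebra.comul (R := k) Λ) =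
        TensorProduct.map τ LinearMap.id (Coalgebra.comul (R := k) Λ) := by
      rw [← hΔ, ← TensorProduct.map_comm, hΛcc]
    simp only [D, σ, twistedTensorAction_apply, trace_comm_tensorAction, hτ', ← hmap]
    simp [twistedMulMap]
  have key (c : k) (hc : c ≠ 0) :
      LinearMap.trace k V (ρ (twistedMulMap k H τ 1 Λ)) = c ↔
      ∃ f : Module.Dual k V →ₗ[k] V,
        f ∈ homHSub k H V τ ρ ∧ f ≠ 0 ∧ transposeMap k V f = c • f := by
    rw [htrace, trace_mul_eq_iff_exists_eigenvector k σ (D Λ) _ hσ _ hc,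
      (tensorEquivDualHom k V).surjective.exists]
    · refine exists_congr fun t => ?_
      rw [hinv, ← tensorEquivDualHom_comm, ← map_smul, (tensorEquivDualHom k V).injective.eq_iff,
        Ne, Ne, (tensorEquivDualHom k V).map_eq_zero_iff]
      rfl
    · intro x
      rw [hDΛ, hΛone, one_smul]
    · intro x y hx hy hx0
      obtain ⟨c, hc⟩ := exists_eq_smul_of_mem_homHSub k τ ρ hirr ((hinv x).mpr hx)
        ((hinv y).mpr hy) (by simpa using hx0)
      exact ⟨c, (tensorEquivDualHom k V).injective (by rw [hc, map_smul])⟩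
  exact ⟨by simpa using key 1 one_ne_zero, by simpa using key (-1) (by simp)⟩

end
end

section
/- Let τ be a Hopf algebra automorphism of H with τ² = Id, and let (V,ρ) be any finite-dimensional left H-module with character χ. Then ν₂(χ,τ) = dim Sym_H(V†,V) − dim Alt_H(V†,V). -/
open TensorProduct

noncomputable section

universe u

variable (k : Type u) [Field k]

section LinearAlgebra

variable {k}

/-- If an involution `t` commutes with a projection `P` onto `p`, then the trace of `t * P` is the
difference of the dimensions of the `±1`-eigenspaces of `t` on `p`. -/
theorem trace_involution_mul_isProj [CharZero k] {W : Type*} [AddCommGroup W] [Module k W]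
    [FiniteDimensional k W] {p : Submodule k W} {P t : Module.End k W}
    (hP : LinearMap.IsProj p P) (ht : ∀ w, t (t w) = w) (hcomm : ∀ w, t (P w) = P (t w)) :
    LinearMap.trace k W (t * P) =
      (Module.finrank k (p ⊓ LinearMap.eqLocus t (LinearMap.id : W →ₗ[k] W) : Submodule k W) : k) -
      (Module.finrank k
        (p ⊓ LinearMap.eqLocus t (-(LinearMap.id : W →ₗ[k] W)) : Submodule k W) : k) := by
  have two_ne : (2 : k) ≠ 0 := two_ne_zero
  have hmem {w : W} (hw : w ∈ p) : t w ∈ p := by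
    rw [← hP.map_id w hw, hcomm]
    exact hP.map_mem _
  have hplus : LinearMap.IsProj (p ⊓ LinearMap.eqLocus t (LinearMap.id : W →ₗ[k] W))
      ((2⁻¹ : k) • (P + t * P) : Module.End k W) := by
    refine ⟨fun w => ⟨?_, ?_⟩, fun w hw => ?_⟩
    · exact p.smul_mem _ (p.add_mem (hP.map_mem w) (hmem (hP.map_mem w)))
    · change t _ = _
      simp [ht, add_comm]
    · have h₁ := hP.map_id w hw.1
      have h₂ : t w = w := hw.2
      simp only [LinearMap.smul_apply, LinearMap.add_apply, Module.End.mul_apply, h₁, h₂]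
      rw [← two_smul k w, smul_smul, inv_mul_cancel₀ two_ne, one_smul]
  have hminus : LinearMap.IsProj (p ⊓ LinearMap.eqLocus t (-(LinearMap.id : W →ₗ[k] W)))
      ((2⁻¹ : k) • (P - t * P) : Module.End k W) := by
    refine ⟨fun w => ⟨?_, ?_⟩, fun w hw => ?_⟩
    · exact p.smul_mem _ (p.sub_mem (hP.map_mem w) (hmem (hP.map_mem w)))
    · change t _ = - _
      simp [ht, ← smul_neg]
    · have h₁ := hP.map_id w hw.1
      have h₂ : t w = -w := hw.2
      simp only [LinearMap.smul_apply, LinearMap.sub_apply, Module.End.mul_apply, h₁, h₂]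
      rw [sub_neg_eq_add, ← two_smul k w, smul_smul, inv_mul_cancel₀ two_ne, one_smul]
  rw [← hplus.trace, ← hminus.trace, ← map_sub, ← smul_sub]
  congr 1
  rw [add_sub_sub_cancel, ← two_smul k, smul_smul, inv_mul_cancel₀ two_ne, one_smul]

variable {V : Type u} [AddCommGroup V] [Module k V]

theorem dual_separation {x y : V} (h : ∀ φ : Module.Dual k V, φ x = φ y) : x = y :=
  (Module.forall_dual_apply_eq_zero_iff k (x - y)).1 (fun φ => by rw [map_sub, h, sub_self])
    |> sub_eq_zero.1

/-- The action `f ↦ b ∘ f ∘ a*` of `End V ⊗ End V` on `Hom(V*, V)`. -/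
def sandwich (V : Type u) [AddCommGroup V] [Module k V] :
    Module.End k V ⊗[k] Module.End k V →ₐ[k] Module.End k (Module.Dual k V →ₗ[k] V) :=
  Algebra.TensorProduct.lift
    (AlgHom.ofLinearMap
      ((LinearMap.llcomp k (Module.Dual k V) (Module.Dual k V) V).flip ∘ₗ
        Module.Dual.transpose (R := k)) rfl fun _ _ => rfl)
    (AlgHom.ofLinearMap (LinearMap.llcomp k (Module.Dual k V) V V) rfl fun _ _ => rfl)
    (fun _ _ => rfl)

theorem sandwich_tmul_apply (a b : Module.End k V) (f : Module.Dual k V →ₗ[k] V) :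
    sandwich V (a ⊗ₜ b) f = b ∘ₗ f ∘ₗ a.dualMap := rfl

variable [FiniteDimensional k V]

theorem dual_transposeMap_apply (f : Module.Dual k V →ₗ[k] V) (φ ψ : Module.Dual k V) :
    φ (transposeMap k V f ψ) = ψ (f φ) := by
  change φ ((Module.evalEquiv k V).symm (Module.Dual.transpose (R := k) f ψ)) = _
  rw [Module.apply_evalEquiv_symm_apply]
  rfl

theorem transposeMap_transposeMap (f : Module.Dual k V →ₗ[k] V) :
    transposeMap k V (transposeMap k V f) = f := by
  refine LinearMap.ext fun ψ => dual_separation (k := k) fun φ => ?_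
  rw [dual_transposeMap_apply, dual_transposeMap_apply]

theorem transposeMap_comp_comp_dualMap (a b : Module.End k V) (f : Module.Dual k V →ₗ[k] V) :
    transposeMap k V (b ∘ₗ f ∘ₗ a.dualMap) = a ∘ₗ transposeMap k V f ∘ₗ b.dualMap := by
  ext ψ
  refine dual_separation (k := k) fun φ => ?_
  rw [dual_transposeMap_apply]
  exact (dual_transposeMap_apply f (a.dualMap φ) (b.dualMap ψ)).symm

theorem transposeMap_sandwich (x : Module.End k V ⊗[k] Module.End k V)
    (f : Module.Dual k V →ₗ[k] V) :
    transposeMap k V (sandwich V x f) =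
      sandwich V (TensorProduct.comm k _ _ x) (transposeMap k V f) := by
  induction x using TensorProduct.induction_on with
  | zero => simp
  | add x y hx hy => simp only [map_add, LinearMap.add_apply, hx, hy]
  | tmul a b =>
    rw [TensorProduct.comm_tmul, sandwich_tmul_apply, sandwich_tmul_apply,
      transposeMap_comp_comp_dualMap]

theorem trace_transposeMap_mul_sandwich (x : Module.End k V ⊗[k] Module.End k V) :
    LinearMap.trace k _ (transposeMap k V * sandwich V x) =
      LinearMap.trace k V (LinearMap.mul' k _ x) := by
  induction x using TensorProduct.induction_on with
  | zero => simp
  | add x y hx hy => simp only [map_add, mul_add, hx, hy]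
  | tmul a b =>
    obtain ⟨a, rfl⟩ := (dualTensorHomEquiv k V V).surjective a
    obtain ⟨b, rfl⟩ := (dualTensorHomEquiv k V V).surjective b
    induction a using TensorProduct.induction_on with
    | zero => simp
    | add x y hx hy => simp only [map_add, mul_add, TensorProduct.add_tmul, hx, hy]
    | tmul φ v =>
      induction b using TensorProduct.induction_on with
      | zero => simp
      | add x y hx hy => simp only [map_add, mul_add, TensorProduct.tmul_add, hx, hy]
      | tmul ψ w =>
        have h₁ : transposeMap k V * sandwich V
            (dualTensorHomEquiv k V V (φ ⊗ₜ v) ⊗ₜ dualTensorHomEquiv k V V (ψ ⊗ₜ w)) =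
            (ψ ∘ₗ LinearMap.applyₗ φ : (Module.Dual k V →ₗ[k] V) →ₗ[k] k).smulRight
              ((LinearMap.applyₗ w).smulRight v) := by
          refine LinearMap.ext fun f => LinearMap.ext fun χ => ?_
          rw [Module.End.mul_apply, sandwich_tmul_apply, transposeMap_comp_comp_dualMap]
          have hχ : (dualTensorHomEquiv k V V (ψ ⊗ₜ w)).dualMap χ = χ w • ψ := by
            ext x
            simp [mul_comm]
          rw [LinearMap.comp_apply, LinearMap.comp_apply, hχ, map_smul, map_smul]
          simp [dual_transposeMap_apply, smul_smul, mul_comm]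
        have h₂ : LinearMap.mul' k _
            (dualTensorHomEquiv k V V (φ ⊗ₜ v) ⊗ₜ dualTensorHomEquiv k V V (ψ ⊗ₜ w)) =
            (ψ : V →ₗ[k] k).smulRight (φ w • v) := by
          ext x
          simp [smul_smul, mul_comm]
        rw [h₁, h₂, LinearMap.trace_smulRight, LinearMap.trace_smulRight]
        simp

end LinearAlgebra

section Hopf

variable {k}

open HopfAlgebra Coalgebra

variable {H : Type u} [Ring H] [HopfAlgebra k H]

theorem sum_antipode_tmul_one_mul_comul {ι : Type*} {h : H} (r : Repr k h ι) :
    ∑ i ∈ r.index, (antipode k (r.left i) ⊗ₜ[k] (1 : H)) * comul (R := k) (r.right i) =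
      1 ⊗ₜ h := by
  let F : H ⊗[k] (H ⊗[k] H) →ₗ[k] H ⊗[k] H :=
    LinearMap.mul' k (H ⊗[k] H) ∘ₗ
      ((Algebra.TensorProduct.includeLeft : H →ₐ[k] H ⊗[k] H).toLinearMap ∘ₗ
        antipode k).rTensor (H ⊗[k] H)
  have hF : F ∘ₗ (TensorProduct.assoc k H H H).toLinearMap =
      (LinearMap.mul' k H ∘ₗ (antipode k).rTensor H).rTensor H := by
    ext x y z
    simp [F]
  calc
    _ = F (comul.lTensor H (comul (R := k) h)) := by
      rw [← r.eq]
      simp [F]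
    _ = (F ∘ₗ (TensorProduct.assoc k H H H).toLinearMap) (comul.rTensor H (comul (R := k) h)) := by
      rw [← coassoc_apply]
      rfl
    _ = (Algebra.linearMap k H).rTensor H (counit.rTensor H (comul (R := k) h)) := by
      rw [hF, ← LinearMap.rTensor_comp_apply, ← LinearMap.rTensor_comp_apply,
        LinearMap.comp_assoc, mul_antipode_rTensor_comul]
    _ = 1 ⊗ₜ h := by simp

/-- Invariance of `w` under the diagonal action through `B : H ⊗ H → End W` means that acting on
the second factor is the same as acting through the antipode on the first factor. -/
theorem comul_apply_eq_counit_smul_iff {W : Type*} [AddCommGroup W] [Module k W]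
    (B : H ⊗[k] H →ₐ[k] Module.End k W) (w : W) :
    (∀ h : H, B (comul (R := k) h) w = counit (R := k) h • w) ↔
      ∀ h : H, B (1 ⊗ₜ h) w = B (antipode k h ⊗ₜ 1) w := by
  refine ⟨fun hw h => ?_, fun hw h => ?_⟩ <;> let r := ℛ k h
  · rw [← sum_antipode_tmul_one_mul_comul r]
    simp only [map_sum, map_mul, LinearMap.sum_apply, Module.End.mul_apply, hw, map_smul]
    have hr : ∑ i ∈ r.index, counit (R := k) (r.right i) • r.left i = h := by
      have h₁ := congrArg (TensorProduct.rid k H) (sum_tmul_counit_eq r)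
      simpa only [map_sum, TensorProduct.rid_tmul, one_smul] using h₁
    conv_rhs => rw [← hr]
    simp [TensorProduct.sum_tmul, ← TensorProduct.smul_tmul']
  · have hsplit (x y : H) : x ⊗ₜ[k] y = (x ⊗ₜ 1) * (1 ⊗ₜ y) := by simp
    have hmul (x y : H) : B (x ⊗ₜ 1) (B (y ⊗ₜ 1) w) = B ((x * y) ⊗ₜ 1) w := by
      rw [← Module.End.mul_apply, ← map_mul, Algebra.TensorProduct.tmul_mul_tmul, one_mul]
    calc
      _ = ∑ i ∈ r.index, B (r.left i ⊗ₜ 1) (B (1 ⊗ₜ r.right i) w) := by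
        rw [← r.eq, map_sum, LinearMap.sum_apply]
        refine Finset.sum_congr rfl fun i _ => ?_
        rw [hsplit, map_mul, Module.End.mul_apply]
      _ = B ((∑ i ∈ r.index, r.left i * antipode k (r.right i)) ⊗ₜ 1) w := by
        simp only [hw, hmul, TensorProduct.sum_tmul, map_sum, LinearMap.sum_apply]
      _ = counit (R := k) h • w := by
        rw [sum_mul_antipode_eq_smul, ← TensorProduct.smul_tmul', map_smul,
          ← Algebra.TensorProduct.one_def, map_one]
        rfl

/-- An integral with counit one acts as a projection onto the invariants. -/
theorem isProj_integral {W : Type*} [AddCommGroup W] [Module k W] {p : Submodule k W}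
    (σ : H →ₐ[k] Module.End k W) (hp : ∀ w, w ∈ p ↔ ∀ h, σ h w = counit (R := k) h • w)
    {Λ : H} (hΛ : ∀ a : H, a * Λ = counit (R := k) a • Λ) (hΛone : counit (R := k) Λ = 1) :
    LinearMap.IsProj p (σ Λ) where
  map_mem w := (hp _).2 fun h => by
    rw [← Module.End.mul_apply, ← map_mul, hΛ, map_smul, LinearMap.smul_apply]
  map_id w hw := by rw [(hp w).1 hw, hΛone, one_smul]

end Hopf

/-- **Theorem.** For any finite-dimensional module `(V, ρ)` over a finite-dimensional semisimple
Hopf algebra `H` over an algebraically closed field of characteristic `0`, and a Hopf algebra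
automorphism `τ` with `τ² = Id`, the second twisted Frobenius–Schur indicator satisfies
`ν₂(χ, τ) = dim Sym_H(V†, V) - dim Alt_H(V†, V)`, where `Sym` (resp. `Alt`) consists of the
`H`-module maps `V† → V` fixed (resp. negated) by the transpose. -/
theorem twisted_second_FS_indicator_eq_dim_sym_sub_dim_alt
    (H V : Type u) [Ring H] [HopfAlgebra k H]
    [IsAlgClosed k] [CharZero k] [FiniteDimensional k H] [IsSemisimpleRing H]
    [AddCommGroup V] [Module k V] [FiniteDimensional k V]
    (Λ : H)
    (hΛleft : ∀ a : H, a * Λ = Coalgebra.counit (R := k) a • Λ)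
    (hΛright : ∀ a : H, Λ * a = Coalgebra.counit (R := k) a • Λ)
    (hΛone : Coalgebra.counit (R := k) Λ = 1)
    (hΛcc : TensorProduct.comm k H H (Coalgebra.comul (R := k) Λ) = Coalgebra.comul (R := k) Λ)
    (τ : H →ₗ[k] H)
    (hτmul : ∀ a b : H, τ (a * b) = τ a * τ b) (hτone : τ 1 = 1)
    (hτcomul : Coalgebra.comul (R := k) ∘ₗ τ =
      TensorProduct.map τ τ ∘ₗ Coalgebra.comul (R := k))
    (hτcounit : Coalgebra.counit (R := k) ∘ₗ τ = Coalgebra.counit (R := k))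
    (hτsq : τ ∘ₗ τ = LinearMap.id)
    (ρ : H →ₐ[k] Module.End k V)
    :
    LinearMap.trace k V (ρ (twistedMulMap k H τ 1 Λ)) =
      (Module.finrank k
        (homHSub k H V τ ρ ⊓ LinearMap.eqLocus (transposeMap k V)
          (LinearMap.id : (Module.Dual k V →ₗ[k] V) →ₗ[k] (Module.Dual k V →ₗ[k] V)) :
            Submodule k (Module.Dual k V →ₗ[k] V)) : k) -
      (Module.finrank k
        (homHSub k H V τ ρ ⊓ LinearMap.eqLocus (transposeMap k V)
          (-(LinearMap.id : (Module.Dual k V →ₗ[k] V) →ₗ[k] (Module.Dual k V →ₗ[k] V))) :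
            Submodule k (Module.Dual k V →ₗ[k] V)) : k) := by
  let τA : H →ₐ[k] H := AlgHom.ofLinearMap τ hτone hτmul
  let B : H ⊗[k] H →ₐ[k] Module.End k (Module.Dual k V →ₗ[k] V) :=
    (sandwich V).comp (Algebra.TensorProduct.map (ρ.comp τA) ρ)
  have hτΛ : τ Λ = Λ := by
    have h₁ : Λ * τ Λ = τ Λ := by
      have h := congrArg τ (hΛleft (τ Λ))
      rw [hτmul, map_smul, ← LinearMap.comp_apply, hτsq, ← LinearMap.comp_apply, hτcounit,
        hΛone, one_smul] at h
      exact h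
    rw [← h₁, hΛright, ← LinearMap.comp_apply, hτcounit, hΛone, one_smul]
  have hcomul : TensorProduct.map τ LinearMap.id (Coalgebra.comul (R := k) Λ) =
      TensorProduct.map LinearMap.id τ (Coalgebra.comul (R := k) Λ) := by
    have h : Coalgebra.comul (R := k) Λ =
        TensorProduct.map τ τ (Coalgebra.comul (R := k) Λ) := by
      rw [← LinearMap.comp_apply, ← hτcomul, LinearMap.comp_apply, hτΛ]
    conv_lhs => rw [h]
    rw [← LinearMap.comp_apply, ← TensorProduct.map_comp, hτsq, LinearMap.id_comp]
  have hB : Algebra.TensorProduct.map (ρ.comp τA) ρ (Coalgebra.comul (R := k) Λ) =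
      Algebra.TensorProduct.map ρ (ρ.comp τA) (Coalgebra.comul (R := k) Λ) := by
    have h := congrArg (TensorProduct.map ρ.toLinearMap ρ.toLinearMap) hcomul
    rw [TensorProduct.map_map, TensorProduct.map_map] at h
    exact h
  have hmem (f : Module.Dual k V →ₗ[k] V) : f ∈ homHSub k H V τ ρ ↔
      ∀ h : H, B (Coalgebra.comul (R := k) h) f = Coalgebra.counit (R := k) h • f := by
    rw [comul_apply_eq_counit_smul_iff]
    refine forall_congr' fun h => ?_
    simp [B, sandwich_tmul_apply, τA, hτone, Module.End.one_eq_id]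
  have hproj : LinearMap.IsProj (homHSub k H V τ ρ) (B (Coalgebra.comul (R := k) Λ)) :=
    isProj_integral (B.comp (Bialgebra.comulAlgHom k H)) hmem hΛleft hΛone
  rw [← trace_involution_mul_isProj hproj transposeMap_transposeMap]
  · change _ = LinearMap.trace k _ (transposeMap k V * sandwich V (Algebra.TensorProduct.map
      (ρ.comp τA) ρ (Coalgebra.comul (R := k) Λ)))
    rw [trace_transposeMap_mul_sandwich, hB]
    have hmul : ρ.toLinearMap ∘ₗ LinearMap.mul' k H ∘ₗ TensorProduct.map LinearMap.id τ =
        LinearMap.mul' k _ ∘ₗ (Algebra.TensorProduct.map ρ (ρ.comp τA)).toLinearMap := by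
      ext x y
      simp [τA]
    exact congrArg (LinearMap.trace k V) (LinearMap.congr_fun hmul (Coalgebra.comul (R := k) Λ))
  · intro f
    have hswap (x : H ⊗[k] H) : TensorProduct.comm k _ _
        (Algebra.TensorProduct.map (ρ.comp τA) ρ x) =
        Algebra.TensorProduct.map ρ (ρ.comp τA) (TensorProduct.comm k H H x) := by
      induction x using TensorProduct.induction_on with
      | zero => simp
      | add x y hx hy => simp only [map_add, hx, hy]
      | tmul x y => rfl
    change transposeMap k V (sandwich V (Algebra.TensorProduct.map (ρ.comp τA) ρ _) f) =
      sandwich V (Algebra.TensorProduct.map (ρ.comp τA) ρ _) _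
    rw [transposeMap_sandwich, hswap, hΛcc, hB]

end
end
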